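/- Let d ≥ 1 and set ε_d = (2+d)^{-1/2}. Then σ^∞_d(3^d) = (1+d)^{-1/2} > ε_d and σ^∞_d(n) = 0 for all n > 3^d; consequently the information complexity satisfies n(ε_d, d) := min{n ∈ ℕ : σ^∞_d(n+1) ≤ ε_d} = 3^d. -/

import Mathlib

/-- nonincreasing rearrangement of the weights `(1 + Σ_j |k_j|)^{-1/2}`, `k ∈ {-1,0,1}^d`. -/
noncomputable def sigmaInf (d : ℕ) (n : ℕ) : ℝ :=
  sSup {t : ℝ | 0 < t ∧
    n ≤ Set.ncard {k : Fin d → ℤ | (∀ j, |k j| ≤ 1) ∧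
      t ≤ (1 + ∑ j, |(k j : ℝ)|) ^ (-(1 / 2) : ℝ)}}

lemma box_eq_coe (d : ℕ) :
    {k : Fin d → ℤ | ∀ j, |k j| ≤ 1} =
      ((Fintype.piFinset fun _ => Finset.Icc (-1 : ℤ) 1 : Finset (Fin d → ℤ)) :
        Set (Fin d → ℤ)) := by
  ext k
  simp only [Set.mem_ofPred_eq, Finset.mem_coe, Fintype.mem_piFinset, Finset.mem_Icc, abs_le]

lemma box_finite (d : ℕ) : {k : Fin d → ℤ | ∀ j, |k j| ≤ 1}.Finite := by
  rw [box_eq_coe]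
  exact Finset.finite_toSet _

lemma ncard_box (d : ℕ) : Set.ncard {k : Fin d → ℤ | ∀ j, |k j| ≤ 1} = 3 ^ d := by
  rw [box_eq_coe, Set.ncard_coe_finset]
  simp

lemma weight_le_one {d : ℕ} (k : Fin d → ℤ) :
    (1 + ∑ j, |(k j : ℝ)|) ^ (-(1 / 2) : ℝ) ≤ 1 := by
  have h : 0 ≤ ∑ j, |(k j : ℝ)| := Finset.sum_nonneg fun _ _ => abs_nonneg _
  exact Real.rpow_le_one_of_one_le_of_nonpos (by linarith) (by norm_num)

lemma le_weight {d : ℕ} {k : Fin d → ℤ} (hk : ∀ j, |k j| ≤ 1) :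
    (1 + (d : ℝ)) ^ (-(1 / 2) : ℝ) ≤ (1 + ∑ j, |(k j : ℝ)|) ^ (-(1 / 2) : ℝ) := by
  have h : 0 ≤ ∑ j, |(k j : ℝ)| := Finset.sum_nonneg fun _ _ => abs_nonneg _
  have h' : ∑ j, |(k j : ℝ)| ≤ d := by
    calc ∑ j, |(k j : ℝ)| ≤ ∑ _j : Fin d, (1 : ℝ) :=
          Finset.sum_le_sum fun j _ => by exact_mod_cast hk j
      _ = d := by simp
  exact Real.rpow_le_rpow_of_nonpos (by linarith) (by linarith) (by norm_num)

lemma sigmaInf_eq_zero {d n : ℕ} (hn : 3 ^ d < n) : sigmaInf d n = 0 := by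
  have hempty : {t : ℝ | 0 < t ∧
      n ≤ Set.ncard {k : Fin d → ℤ | (∀ j, |k j| ≤ 1) ∧
        t ≤ (1 + ∑ j, |(k j : ℝ)|) ^ (-(1 / 2) : ℝ)}} = ∅ := by
    refine Set.eq_empty_iff_forall_notMem.2 fun t ht => ?_
    have h := Set.ncard_le_ncard (fun k hk => hk.1 :
      {k : Fin d → ℤ | (∀ j, |k j| ≤ 1) ∧ t ≤ (1 + ∑ j, |(k j : ℝ)|) ^ (-(1 / 2) : ℝ)} ⊆
        {k : Fin d → ℤ | ∀ j, |k j| ≤ 1}) (box_finite d)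
    replace h := h.trans (ncard_box d).le
    exact absurd (ht.2.trans h) hn.not_ge
  rw [sigmaInf, hempty, Real.sSup_empty]

lemma le_sigmaInf {d n : ℕ} (hn : 1 ≤ n) (hnd : n ≤ 3 ^ d) :
    (1 + (d : ℝ)) ^ (-(1 / 2) : ℝ) ≤ sigmaInf d n := by
  refine le_csSup ⟨1, fun t ht => ?_⟩ ⟨by positivity, ?_⟩
  · obtain ⟨k, hk⟩ := Set.nonempty_of_ncard_ne_zero (Nat.one_le_iff_ne_zero.1 (hn.trans ht.2))
    exact hk.2.trans (weight_le_one k)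
  · have h : {k : Fin d → ℤ | (∀ j, |k j| ≤ 1) ∧
        (1 + (d : ℝ)) ^ (-(1 / 2) : ℝ) ≤ (1 + ∑ j, |(k j : ℝ)|) ^ (-(1 / 2) : ℝ)} =
        {k : Fin d → ℤ | ∀ j, |k j| ≤ 1} :=
      Set.ext fun k => ⟨fun hk => hk.1, fun hk => ⟨hk, le_weight hk⟩⟩
    rwa [h, ncard_box]

lemma sigmaInf_three_pow_le (d : ℕ) :
    sigmaInf d (3 ^ d) ≤ (1 + (d : ℝ)) ^ (-(1 / 2) : ℝ) := by
  refine Real.sSup_le (fun t ht => ?_) (by positivity)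
  have h := Set.eq_of_subset_of_ncard_le (fun k hk => hk.1 :
      {k : Fin d → ℤ | (∀ j, |k j| ≤ 1) ∧ t ≤ (1 + ∑ j, |(k j : ℝ)|) ^ (-(1 / 2) : ℝ)} ⊆
        {k : Fin d → ℤ | ∀ j, |k j| ≤ 1}) ((ncard_box d).le.trans ht.2) (box_finite d)
  have hmem : (fun _ => 1 : Fin d → ℤ) ∈ {k : Fin d → ℤ | ∀ j, |k j| ≤ 1} := by simp
  rw [← h] at hmem
  simpa using hmem.2

/-- with `ε_d = (2+d)^{-1/2}`, one has `σ^∞_d(3^d) = (1+d)^{-1/2} > ε_d`,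
`σ^∞_d(n) = 0` for all `n > 3^d`, and hence the information complexity
`n(ε_d,d) = min{n : σ^∞_d(n+1) ≤ ε_d} = 3^d`. -/
theorem stmt_16 (d : ℕ) (hd : 1 ≤ d) :
    sigmaInf d (3 ^ d) = (1 + (d : ℝ)) ^ (-(1 / 2) : ℝ) ∧
    (2 + (d : ℝ)) ^ (-(1 / 2) : ℝ) < (1 + (d : ℝ)) ^ (-(1 / 2) : ℝ) ∧
    (∀ n : ℕ, 3 ^ d < n → sigmaInf d n = 0) ∧
    sInf {n : ℕ | sigmaInf d (n + 1) ≤ (2 + (d : ℝ)) ^ (-(1 / 2) : ℝ)} = 3 ^ d := by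
  have hlt : (2 + (d : ℝ)) ^ (-(1 / 2) : ℝ) < (1 + (d : ℝ)) ^ (-(1 / 2) : ℝ) :=
    Real.rpow_lt_rpow_of_neg (by positivity) (by linarith) (by norm_num)
  refine ⟨(sigmaInf_three_pow_le d).antisymm (le_sigmaInf (Nat.one_le_pow _ _ (by norm_num)) le_rfl), hlt,
    fun n hn => sigmaInf_eq_zero hn, IsLeast.csInf_eq ⟨?_, fun n hn => ?_⟩⟩
  · rw [Set.mem_ofPred_eq, sigmaInf_eq_zero (Nat.lt_succ_self _)]
    positivity
  · by_contra! h
    exact absurd ((le_sigmaInf (Nat.le_add_left 1 n) h).trans hn) hlt.not_ge
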